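/- arXiv:2508.08156 — 3 statements merged into one kernel-verified Lean document; each statement's English description precedes it below -/
import Mathlib

section
/- Let Ω ⊆ ℝⁿ be open, C a convex body in ℝⁿ whose interior contains the origin, ε > 0, and E ⊆ Ω measurable. Then 𝔐_{ε,C}(∂E; Ω) ≥ 𝓜_{ε,C}(E; Ω) ≥ M_{ε,C}(∂E; Ω), where 𝓜_{ε,C}(E; Ω) := (1/2)(SM_{ε,C}(E; Ω) + SM_{ε,C}(Ω∖E; Ω)). Moreover, if closure(E) ⊆ Ω, then the three quantities coincide; in particular, for Ω = ℝⁿ all three coincide for every measurable E ⊆ ℝⁿ and every ε > 0. -/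
open MeasureTheory Filter Set Metric
open scoped ENNReal NNReal Topology Pointwise RealInnerProductSpace

noncomputable section

/-- A convex body in `ℝⁿ` whose interior contains the origin. -/
def IsConvexBody0 {n : ℕ} (C : Set (EuclideanSpace ℝ (Fin n))) : Prop :=
  Convex ℝ C ∧ IsCompact C ∧ C.Nonempty ∧ (0 : EuclideanSpace ℝ (Fin n)) ∈ interior C

/-- The support function `h_C(y) = sup_{x ∈ C} ⟪x, y⟫`. -/
def suppFn {n : ℕ} (C : Set (EuclideanSpace ℝ (Fin n))) (y : EuclideanSpace ℝ (Fin n)) : ℝ :=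
  sSup ((fun x => ⟪x, y⟫) '' C)

/-- The set of points where `E` has Lebesgue density `t`. -/
def densityPts {n : ℕ} (E : Set (EuclideanSpace ℝ (Fin n))) (t : ℝ≥0∞) :
    Set (EuclideanSpace ℝ (Fin n)) :=
  {x | Tendsto (fun r : ℝ => volume (E ∩ ball x r) / volume (ball x r)) (𝓝[>] (0:ℝ)) (𝓝 t)}

/-- `ν` is a unit vector and the blow-ups `(E - x)/ε` converge in `L¹_loc`, as `ε → 0⁺`,
to the halfspace `{y | ⟪y, ν⟫ ≤ 0}`. -/
def IsBlowUpNormal {n : ℕ} (E : Set (EuclideanSpace ℝ (Fin n)))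
    (x ν : EuclideanSpace ℝ (Fin n)) : Prop :=
  ‖ν‖ = 1 ∧ ∀ K : Set (EuclideanSpace ℝ (Fin n)), IsCompact K →
    Tendsto (fun ε : ℝ =>
        volume ((symmDiff ((fun y => (ε⁻¹ : ℝ) • (y - x)) '' E) {y | ⟪y, ν⟫ ≤ 0}) ∩ K))
      (𝓝[>] (0:ℝ)) (𝓝 0)

/-- The reduced boundary `∂*E` of `E`. -/
def reducedBoundary {n : ℕ} (E : Set (EuclideanSpace ℝ (Fin n))) :
    Set (EuclideanSpace ℝ (Fin n)) :=
  {x | x ∈ densityPts E (1/2) ∧ ∃ ν, IsBlowUpNormal E x ν}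

open Classical in
/-- The measure-theoretic outer unit normal `ν_E` of `E` (meaningful on the reduced boundary). -/
def outerNormal {n : ℕ} (E : Set (EuclideanSpace ℝ (Fin n))) (x : EuclideanSpace ℝ (Fin n)) :
    EuclideanSpace ℝ (Fin n) :=
  if h : ∃ ν, IsBlowUpNormal E x ν then h.choose else 0

/-- The anisotropic perimeter `Per_{h_C}(E; Ω) = ∫_{Ω ∩ ∂*E} h_C(ν_E) dH^{n-1}`. -/
def aniPer {n : ℕ} (C E Ω : Set (EuclideanSpace ℝ (Fin n))) : ℝ≥0∞ :=
  ∫⁻ x in Ω ∩ reducedBoundary E, ENNReal.ofReal (suppFn C (outerNormal E x)) ∂(μH[(n : ℝ) - 1])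

/-- The divergence of a vector field, i.e. the trace of its derivative. -/
def divg {n : ℕ} (φ : EuclideanSpace ℝ (Fin n) → EuclideanSpace ℝ (Fin n))
    (x : EuclideanSpace ℝ (Fin n)) : ℝ :=
  LinearMap.trace ℝ (EuclideanSpace ℝ (Fin n)) (fderiv ℝ φ x).toLinearMap

/-- The (De Giorgi) perimeter of `E` in `Ω`: the total variation of the distributional
derivative `Dχ_E` in `Ω`, computed as the supremum of `∫_E div φ` over smooth compactly
supported vector fields `φ` in `Ω` with `‖φ‖ ≤ 1`. -/
def perimeter {n : ℕ} (E Ω : Set (EuclideanSpace ℝ (Fin n))) : ℝ≥0∞ :=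
  ⨆ φ ∈ {φ : EuclideanSpace ℝ (Fin n) → EuclideanSpace ℝ (Fin n) |
      ContDiff ℝ (⊤ : ℕ∞) φ ∧ HasCompactSupport φ ∧ tsupport φ ⊆ Ω ∧ ∀ x, ‖φ x‖ ≤ 1},
    ENNReal.ofReal (∫ x in E, divg φ x)

/-- `E` is a set of finite perimeter in `Ω`. -/
def HasFinitePerimeterIn {n : ℕ} (E Ω : Set (EuclideanSpace ℝ (Fin n))) : Prop :=
  MeasurableSet E ∧ perimeter E Ω < ⊤

/-- `M_{ε,C}(S; Ω) = λⁿ(((S ∩ Ω) ⊕ εC) ∩ Ω) / (2ε)`. -/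
def minkC {n : ℕ} (C S Ω : Set (EuclideanSpace ℝ (Fin n))) (ε : ℝ) : ℝ≥0∞ :=
  volume (((S ∩ Ω) + ε • C) ∩ Ω) / ENNReal.ofReal (2 * ε)

/-- `𝔐_{ε,C}(S; Ω) = λⁿ((S ⊕ εC) ∩ Ω) / (2ε)`. -/
def minkFrak {n : ℕ} (C S Ω : Set (EuclideanSpace ℝ (Fin n))) (ε : ℝ) : ℝ≥0∞ :=
  volume ((S + ε • C) ∩ Ω) / ENNReal.ofReal (2 * ε)

/-- `SM_{ε,C}(E; Ω) = λⁿ(((E ∩ Ω) ⊕ εC) ∩ (Ω \ E)) / ε`. -/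
def outerMink {n : ℕ} (C E Ω : Set (EuclideanSpace ℝ (Fin n))) (ε : ℝ) : ℝ≥0∞ :=
  volume (((E ∩ Ω) + ε • C) ∩ (Ω \ E)) / ENNReal.ofReal ε

/-- The sum of a set with a bounded convex neighbourhood `D` of the origin differs from its sum with
the interior of `D` by a null set. -/
theorem measure_add_diff_add_interior {V : Type*} [NormedAddCommGroup V] [NormedSpace ℝ V]
    [FiniteDimensional ℝ V] [MeasurableSpace V] [BorelSpace V] (μ : Measure V)
    [μ.IsAddHaarMeasure] (S : Set V) {D : Set V} (hD : Convex ℝ D) (hb : Bornology.IsBounded D)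
    (h0 : 0 ∈ interior D) : μ ((S + D) \ (S + interior D)) = 0 := by
  set N := (S + D) \ (S + interior D)
  obtain ⟨ρ, hρ, hball⟩ := Metric.isOpen_iff.1 isOpen_interior 0 h0
  obtain ⟨M, -, hDM⟩ := hb.exists_pos_norm_le
  have hae := IsUnifLocDoublingMeasure.ae_tendsto_measure_inter_div μ N (2 * M / ρ)
  rw [← Measure.restrict_apply_self μ N]
  refine measure_mono_null ?_ (ae_iff.1 hae)
  intro x hxN hx
  obtain ⟨⟨p, hp, d, hd, rfl⟩, -⟩ := hxN
  have hlim : Tendsto (fun t : ℝ => t * (ρ / 2)) (𝓝[>] 0) (𝓝[>] 0) := by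
    refine tendsto_nhdsWithin_iff.2 ⟨?_, ?_⟩
    · simpa using (tendsto_id (x := 𝓝 (0 : ℝ))).mul_const (ρ / 2) |>.mono_left nhdsWithin_le_nhds
    · filter_upwards [self_mem_nhdsWithin] with t ht
      exact mul_pos ht (half_pos hρ)
  have key := hx (fun t : ℝ => p + (1 - t) • d) (fun t => t * (ρ / 2)) hlim ?_
  · refine zero_ne_one (tendsto_nhds_unique (tendsto_const_nhds.congr' ?_) key)
    filter_upwards [Ioo_mem_nhdsGT (zero_lt_one' ℝ)] with t ht
    suffices h : N ∩ closedBall (p + (1 - t) • d) (t * (ρ / 2)) = ∅ by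
      rw [h, measure_empty, ENNReal.zero_div]
    refine eq_empty_of_forall_notMem fun y hy => hy.1.2 ⟨p, hp, y - p, ?_, add_sub_cancel p y⟩
    have hy2 : ‖y - p - (1 - t) • d‖ ≤ t * (ρ / 2) := by
      simpa [dist_eq_norm, sub_sub] using hy.2
    have hu : t⁻¹ • (y - p - (1 - t) • d) ∈ interior D := by
      apply hball
      rw [mem_ball_zero_iff, norm_smul, norm_inv, Real.norm_of_nonneg ht.1.le,
        inv_mul_lt_iff₀ ht.1]
      nlinarith [mul_pos ht.1 hρ]
    have := hD.combo_self_interior_mem_interior hd hu (sub_nonneg.2 ht.2.le) ht.1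
      (sub_add_cancel 1 t)
    rwa [smul_inv_smul₀ ht.1.ne', add_sub_cancel] at this
  · filter_upwards [self_mem_nhdsWithin] with t ht
    have ht' : 0 < t := ht
    have hsub : p + d - (p + (1 - t) • d) = t • d := by module
    rw [mem_closedBall, dist_eq_norm, hsub, norm_smul, Real.norm_of_nonneg ht'.le]
    calc t * ‖d‖ ≤ t * M := by gcongr; exact hDM d hd
      _ = 2 * M / ρ * (t * (ρ / 2)) := by field_simp

/-- If `D` is star-shaped at the origin, then moving from a point of `T` by an element of `D` to a
point outside of `T` passes through the frontier of `T`. -/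
theorem mem_frontier_add_of_mem_add {V : Type*} [AddCommGroup V] [Module ℝ V] [TopologicalSpace V]
    [ContinuousAdd V] [ContinuousSMul ℝ V] {T D : Set V} (hD : StarConvex ℝ 0 D) {e d : V}
    (he : e ∈ T) (hd : d ∈ D) (hed : e + d ∉ T) : e + d ∈ frontier T + D := by
  have hg : Continuous fun t : unitInterval => e + (t : ℝ) • d := by fun_prop
  obtain ⟨t, ht⟩ := nonempty_frontier_iff (s := (fun t : unitInterval => e + (t : ℝ) • d) ⁻¹' T)
    |>.2 ⟨⟨0, by simpa using he⟩, fun h => hed (by simpa using h.ge (mem_univ (1 : unitInterval)))⟩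
  refine ⟨_, hg.frontier_preimage_subset T ht, (1 - (t : ℝ)) • d,
    hD.smul_mem hd (sub_nonneg.2 t.2.2) (sub_le_self 1 t.2.1), ?_⟩
  module

/-- For fixed `ε > 0`: `𝔐_{ε,C}(∂E;Ω) ≥ (SM_{ε,C}(E;Ω) + SM_{ε,C}(Ω\E;Ω))/2
≥ M_{ε,C}(∂E;Ω)`; with equalities if `closure E ⊆ Ω`, in particular if `Ω = ℝⁿ`. -/
theorem minkFrak_ge_scrM_ge_minkC {n : ℕ}
    (Ω E C : Set (EuclideanSpace ℝ (Fin n))) (ε : ℝ)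
    (hΩ : IsOpen Ω) (hEΩ : E ⊆ Ω) (hE : MeasurableSet E)
    (hC : IsConvexBody0 C) (hε : 0 < ε) :
    (minkC C (frontier E) Ω ε ≤ (outerMink C E Ω ε + outerMink C (Ω \ E) Ω ε) / 2 ∧
        (outerMink C E Ω ε + outerMink C (Ω \ E) Ω ε) / 2 ≤ minkFrak C (frontier E) Ω ε) ∧
      (closure E ⊆ Ω →
        minkFrak C (frontier E) Ω ε = (outerMink C E Ω ε + outerMink C (Ω \ E) Ω ε) / 2 ∧
          (outerMink C E Ω ε + outerMink C (Ω \ E) Ω ε) / 2 = minkC C (frontier E) Ω ε) ∧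
      (Ω = Set.univ →
        minkFrak C (frontier E) Ω ε = (outerMink C E Ω ε + outerMink C (Ω \ E) Ω ε) / 2 ∧
          (outerMink C E Ω ε + outerMink C (Ω \ E) Ω ε) / 2 = minkC C (frontier E) Ω ε) := by
  have hCε : Convex ℝ (ε • C) := hC.1.smul ε
  have h0 : (0 : EuclideanSpace ℝ (Fin n)) ∈ interior (ε • C) := by
    rw [interior_smul₀ hε.ne']
    exact ⟨0, hC.2.2.2, smul_zero ε⟩
  have hsum : (outerMink C E Ω ε + outerMink C (Ω \ E) Ω ε) / 2 =
      volume ((E + ε • C) ∩ (Ω \ E) ∪ ((Ω \ E) + ε • C) ∩ E) / ENNReal.ofReal (2 * ε) := by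
    have hvol : volume ((E + ε • C) ∩ (Ω \ E) ∪ ((Ω \ E) + ε • C) ∩ E) =
        volume ((E + ε • C) ∩ (Ω \ E)) + volume (((Ω \ E) + ε • C) ∩ E) := by
      rw [← measure_inter_add_sdiff _ hE, add_comm]
      congr 2 <;> ext x <;> simp only [mem_inter_iff, mem_union, Set.mem_sdiff] <;> tauto
    rw [outerMink, outerMink, inter_eq_left.2 hEΩ, inter_eq_left.2 (sdiff_subset : Ω \ E ⊆ Ω),
      Set.sdiff_sdiff_right_self, inter_eq_right.2 hEΩ, ENNReal.div_add_div_same, hvol,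
      ENNReal.ofReal_mul zero_le_two, ENNReal.ofReal_ofNat, div_eq_mul_inv, div_eq_mul_inv,
      div_eq_mul_inv, ENNReal.mul_inv (by simp) (by simp), mul_assoc, mul_comm (2⁻¹ : ℝ≥0∞)]
  have hlow : minkC C (frontier E) Ω ε ≤ (outerMink C E Ω ε + outerMink C (Ω \ E) Ω ε) / 2 := by
    rw [hsum, minkC]
    gcongr ?_ / _
    refine measure_mono_ae (ae_le_set.2 (measure_mono_null ?_
      (measure_add_diff_add_interior volume (frontier E ∩ Ω) hCε (hC.2.1.smul ε).isBounded h0)))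
    rintro x ⟨⟨hxD, hxΩ⟩, hxn⟩
    refine ⟨hxD, ?_⟩
    rintro ⟨p, ⟨hpE, hpΩ⟩, d, hd, rfl⟩
    have hnhds : ∀ᶠ q in 𝓝 p, p + d - q ∈ interior (ε • C) := by
      have hc : ContinuousAt (fun q => p + d - q) p := by fun_prop
      exact hc (isOpen_interior.mem_nhds (by simpa using hd))
    have hsub : ∀ q, p + d - q ∈ interior (ε • C) → ∀ T : Set (EuclideanSpace ℝ (Fin n)),
        q ∈ T → p + d ∈ T + ε • C := fun q hq T hqT =>
      ⟨q, hqT, p + d - q, interior_subset hq, add_sub_cancel q (p + d)⟩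
    refine hxn ?_
    rw [frontier_eq_closure_inter_closure] at hpE
    by_cases hx : p + d ∈ E
    · obtain ⟨q, hq, hqE⟩ := mem_closure_iff_nhds.1 hpE.2 _ (hnhds.and (hΩ.mem_nhds hpΩ))
      exact Or.inr ⟨hsub q hq.1 _ ⟨hq.2, hqE⟩, hx⟩
    · obtain ⟨q, hq, hqE⟩ := mem_closure_iff_nhds.1 hpE.1 _ hnhds
      exact Or.inl ⟨hsub q hq _ hqE, hxΩ, hx⟩
  have hupp : (outerMink C E Ω ε + outerMink C (Ω \ E) Ω ε) / 2 ≤ minkFrak C (frontier E) Ω ε := by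
    rw [hsum, minkFrak]
    gcongr ?_ / _
    refine measure_mono ?_
    have hstar : StarConvex ℝ 0 (ε • C) := hCε.starConvex (interior_subset h0)
    rintro _ (⟨⟨e, he, d, hd, rfl⟩, hxΩ, hx⟩ | ⟨⟨e, he, d, hd, rfl⟩, hx⟩)
    · exact ⟨mem_frontier_add_of_mem_add hstar he hd hx, hxΩ⟩
    · rw [← frontier_compl]
      exact ⟨mem_frontier_add_of_mem_add hstar he.2 hd (not_not.2 hx), hEΩ hx⟩
  have heq : closure E ⊆ Ω →
      minkFrak C (frontier E) Ω ε = (outerMink C E Ω ε + outerMink C (Ω \ E) Ω ε) / 2 ∧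
        (outerMink C E Ω ε + outerMink C (Ω \ E) Ω ε) / 2 = minkC C (frontier E) Ω ε := by
    intro h
    have hM : minkFrak C (frontier E) Ω ε = minkC C (frontier E) Ω ε := by
      rw [minkFrak, minkC, inter_eq_left.2 (frontier_subset_closure.trans h)]
    exact ⟨(hM.trans_le hlow).antisymm hupp, (hupp.trans_eq hM).antisymm hlow⟩
  exact ⟨⟨hlow, hupp⟩, heq, fun h => heq (h ▸ subset_univ _)⟩

end
end

section
/- Let Ω ⊆ ℝⁿ be open, E ⊆ Ω a set of finite perimeter in Ω, and C a convex body in ℝⁿ whose interior contains the origin. If the upper C-anisotropic outer Minkowski content satisfies SM_C(E; Ω)^* = limsup_{ε→0⁺} SM_{ε,C}(E; Ω) < ∞, then λⁿ((closure(E) ∩ Ω) ∖ E) = 0. -/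
open MeasureTheory Filter Set Metric
open scoped ENNReal NNReal Topology Pointwise RealInnerProductSpace

noncomputable section

/-- Dilating by a neighbourhood of the origin covers the closure. -/
theorem closure_subset_add_smul {V : Type*} [NormedAddCommGroup V] [NormedSpace ℝ V]
    (E : Set V) {C : Set V} (hC : C ∈ 𝓝 (0 : V)) {ε : ℝ} (hε : ε ≠ 0) :
    closure E ⊆ E + ε • C := by
  intro x hx
  have hεC : ε • C ∈ 𝓝 (0 : V) := by
    simpa using (smul_mem_nhds_smul_iff₀ hε).2 hC
  have hx' : {y | x - y ∈ ε • C} ∈ 𝓝 x :=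
    (continuous_const.sub continuous_id).continuousAt.preimage_mem_nhds (by simpa using hεC)
  obtain ⟨y, hy, hyE⟩ := mem_closure_iff_nhds.1 hx _ hx'
  exact ⟨y, hyE, x - y, hy, by simp⟩

/-- If the upper `C`-anisotropic outer Minkowski content of `E` is finite, then
`λⁿ((closure E ∩ Ω) \ E) = 0`. -/
theorem limsup_outerMink_lt_top_imp {n : ℕ}
    (Ω E C : Set (EuclideanSpace ℝ (Fin n)))
    (hΩ : IsOpen Ω) (hEΩ : E ⊆ Ω) (hE : HasFinitePerimeterIn E Ω)
    (hC : IsConvexBody0 C)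
    (h : Filter.limsup (fun ε : ℝ => outerMink C E Ω ε) (𝓝[>] (0:ℝ)) < ⊤) :
    volume ((closure E ∩ Ω) \ E) = 0 := by
  obtain ⟨M, hM, hMtop⟩ := exists_between h
  have hbound : ∀ᶠ ε : ℝ in 𝓝[>] (0:ℝ),
      volume ((closure E ∩ Ω) \ E) ≤ M * ENNReal.ofReal ε := by
    filter_upwards [eventually_lt_of_limsup_lt hM, self_mem_nhdsWithin] with ε hlt hε
    have hpos : 0 < ε := hε
    have hsub : (closure E ∩ Ω) \ E ⊆ ((E ∩ Ω) + ε • C) ∩ (Ω \ E) := by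
      rintro x ⟨⟨hx, hxΩ⟩, hxE⟩
      rw [inter_eq_left.2 hEΩ]
      exact ⟨closure_subset_add_smul E (mem_interior_iff_mem_nhds.1 hC.2.2.2) hpos.ne' hx,
        hxΩ, hxE⟩
    refine (measure_mono hsub).trans ?_
    exact (ENNReal.div_le_iff (ENNReal.ofReal_pos.2 hpos).ne' ENNReal.ofReal_ne_top).1 hlt.le
  have hlim : Tendsto (fun ε : ℝ => M * ENNReal.ofReal ε) (𝓝[>] (0:ℝ)) (𝓝 0) := by
    have h0 : Tendsto ENNReal.ofReal (𝓝[>] (0:ℝ)) (𝓝 0) := by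
      simpa using (ENNReal.tendsto_ofReal (tendsto_id (x := 𝓝 (0:ℝ)))).mono_left
        nhdsWithin_le_nhds
    simpa using ENNReal.Tendsto.const_mul h0 (Or.inr hMtop.ne)
  exact nonpos_iff_eq_zero.1 (ge_of_tendsto hlim hbound)

end
end

section
/- Let Ω ⊆ ℝⁿ be open, E ⊆ Ω a set of finite perimeter in Ω, and C a convex body in ℝⁿ whose interior contains the origin. If the limit SM_C(E; Ω) = lim_{ε→0⁺} SM_{ε,C}(E; Ω) exists (as a finite number), then for every set F with E ⊆ F ⊆ closure(E) ∩ Ω (in particular for F with E ⊆ F ⊆ closure(E)), the limit SM_C(F; Ω) exists and equals SM_C(E; Ω). -/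
open MeasureTheory Filter Set Metric
open scoped ENNReal NNReal Topology Pointwise RealInnerProductSpace

noncomputable section

/-- The closure of `E` is contained in `E ⊕ tC` when `0` is interior to `C` and `t > 0`. -/
theorem closure_subset_add_smul_s11 {n : ℕ} {E C : Set (EuclideanSpace ℝ (Fin n))}
    (hC : (0 : EuclideanSpace ℝ (Fin n)) ∈ interior C) {t : ℝ} (ht : 0 < t) :
    closure E ⊆ E + t • C := by
  intro x hx
  have htC : t • C ∈ 𝓝 (0 : EuclideanSpace ℝ (Fin n)) :=
    (set_smul_mem_nhds_zero_iff ht.ne').2 (mem_interior_iff_mem_nhds.1 hC)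
  have hpre : (fun y => x - y) ⁻¹' (t • C) ∈ 𝓝 x := by
    have hcont : ContinuousAt (fun y => x - y) x := by fun_prop
    exact hcont.preimage_mem_nhds (by simpa using htC)
  obtain ⟨y, hy, hyE⟩ := mem_closure_iff_nhds.1 hx _ hpre
  exact ⟨y, hyE, x - y, hy, add_sub_cancel y x⟩

/-- If the outer Minkowski content of `E ⊆ Ω` has a finite limit, then `closure E` exceeds `E`
in `Ω` only by a null set. -/
theorem volume_closure_diff_eq_zero_of_tendsto_outerMink {n : ℕ}
    {Ω E C : Set (EuclideanSpace ℝ (Fin n))} {L : ℝ≥0∞} (hEΩ : E ⊆ Ω)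
    (hC : (0 : EuclideanSpace ℝ (Fin n)) ∈ interior C) (hL : L ≠ ⊤)
    (h : Tendsto (fun ε : ℝ => outerMink C E Ω ε) (𝓝[>] (0:ℝ)) (𝓝 L)) :
    volume (closure E ∩ (Ω \ E)) = 0 := by
  have hε : Tendsto (fun ε : ℝ => ENNReal.ofReal ε) (𝓝[>] (0:ℝ)) (𝓝 0) := by
    have := (ENNReal.continuous_ofReal.tendsto (0:ℝ)).mono_left (nhdsWithin_le_nhds (s := Ioi 0))
    simpa using this
  have hmul : Tendsto (fun ε : ℝ => outerMink C E Ω ε * ENNReal.ofReal ε) (𝓝[>] (0:ℝ)) (𝓝 0) := by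
    simpa using ENNReal.Tendsto.mul h (Or.inr ENNReal.zero_ne_top) hε (Or.inr hL)
  refine le_antisymm (ge_of_tendsto hmul ?_) zero_le
  filter_upwards [self_mem_nhdsWithin] with ε (hpos : 0 < ε)
  rw [outerMink, ENNReal.div_mul_cancel (ENNReal.ofReal_pos.2 hpos).ne' ENNReal.ofReal_ne_top,
    inter_eq_left.2 hEΩ]
  exact measure_mono (inter_subset_inter_left _ (closure_subset_add_smul_s11 hC hpos))

/-- Enlarging `E` within its closure by a null set does not decrease the outer Minkowski
content. -/
theorem outerMink_le_of_subset {n : ℕ} {Ω E F C : Set (EuclideanSpace ℝ (Fin n))}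
    (hEF : E ⊆ F) (hF : F ⊆ closure E) (hnull : volume (closure E ∩ (Ω \ E)) = 0) (ε : ℝ) :
    outerMink C E Ω ε ≤ outerMink C F Ω ε := by
  refine ENNReal.div_le_div_right ?_ _
  rw [← measure_sdiff_null hnull]
  refine measure_mono ?_
  rintro x ⟨⟨hx, hxΩ, hxE⟩, hxN⟩
  exact ⟨add_subset_add_right (inter_subset_inter_left _ hEF) hx, hxΩ,
    fun hxF => hxN ⟨hF hxF, hxΩ, hxE⟩⟩

/-- The outer Minkowski content of a set between `E` and `closure E` is controlled by that of `E`
at a slightly larger scale. -/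
theorem outerMink_le_mul_outerMink {n : ℕ} {Ω E F C : Set (EuclideanSpace ℝ (Fin n))}
    (hEΩ : E ⊆ Ω) (hEF : E ⊆ F) (hF : F ⊆ closure E) (hC : Convex ℝ C)
    (hC0 : (0 : EuclideanSpace ℝ (Fin n)) ∈ interior C) {ε δ : ℝ} (hε : 0 < ε) (hδ : 0 < δ) :
    outerMink C F Ω ε ≤ ENNReal.ofReal (1 + δ) * outerMink C E Ω ((1 + δ) * ε) := by
  have hsub : (F ∩ Ω) + ε • C ⊆ (E ∩ Ω) + ((1 + δ) * ε) • C := by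
    rw [inter_eq_left.2 hEΩ, show (1 + δ) * ε = δ * ε + ε by ring,
      hC.add_smul (mul_pos hδ hε).le hε.le, ← add_assoc]
    exact add_subset_add_right
      ((inter_subset_left.trans hF).trans (closure_subset_add_smul_s11 hC0 (mul_pos hδ hε)))
  have hδ1 : 0 < 1 + δ := by positivity
  rw [outerMink, outerMink, ENNReal.ofReal_mul hδ1.le, ← mul_div_assoc,
    ENNReal.mul_div_mul_left _ _ (ENNReal.ofReal_pos.2 hδ1).ne' ENNReal.ofReal_ne_top]
  exact ENNReal.div_le_div_right
    (measure_mono (inter_subset_inter hsub (sdiff_subset_sdiff_right hEF))) _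

/-- If `SM_C(E;Ω)` exists (finite), then `SM_C(F;Ω)` exists and has the same value for any
`F` with `E ⊆ F ⊆ closure E`. -/
theorem outerMink_of_subset_closure {n : ℕ}
    (Ω E C : Set (EuclideanSpace ℝ (Fin n))) (L : ℝ≥0∞)
    (hΩ : IsOpen Ω) (hEΩ : E ⊆ Ω) (hE : HasFinitePerimeterIn E Ω)
    (hC : IsConvexBody0 C) (hL : L ≠ ⊤)
    (h : Tendsto (fun ε : ℝ => outerMink C E Ω ε) (𝓝[>] (0:ℝ)) (𝓝 L)) :
    ∀ F : Set (EuclideanSpace ℝ (Fin n)), E ⊆ F → F ⊆ closure E →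
      Tendsto (fun ε : ℝ => outerMink C F Ω ε) (𝓝[>] (0:ℝ)) (𝓝 L) := by
  intro F hEF hF
  obtain ⟨hconv, -, -, hC0⟩ := hC
  have hnull := volume_closure_diff_eq_zero_of_tendsto_outerMink hEΩ hC0 hL h
  have hscale : Tendsto (fun ε : ℝ => (1 + ε) * ε) (𝓝[>] (0:ℝ)) (𝓝[>] (0:ℝ)) := by
    refine tendsto_nhdsWithin_iff.2 ⟨?_, ?_⟩
    · have hcont : Continuous (fun ε : ℝ => (1 + ε) * ε) := by fun_prop
      simpa using (hcont.tendsto 0).mono_left (nhdsWithin_le_nhds (s := Ioi 0))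
    · filter_upwards [self_mem_nhdsWithin] with ε (hε : 0 < ε)
      exact mul_pos (by positivity) hε
  have hfactor : Tendsto (fun ε : ℝ => ENNReal.ofReal (1 + ε)) (𝓝[>] (0:ℝ)) (𝓝 1) := by
    have hcont : Continuous (fun ε : ℝ => ENNReal.ofReal (1 + ε)) :=
      ENNReal.continuous_ofReal.comp (by fun_prop)
    simpa using (hcont.tendsto 0).mono_left (nhdsWithin_le_nhds (s := Ioi 0))
  have hupper : Tendsto (fun ε : ℝ => ENNReal.ofReal (1 + ε) * outerMink C E Ω ((1 + ε) * ε))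
      (𝓝[>] (0:ℝ)) (𝓝 L) := by
    simpa using ENNReal.Tendsto.mul hfactor (Or.inl one_ne_zero) (h.comp hscale)
      (Or.inr ENNReal.one_ne_top)
  refine tendsto_of_tendsto_of_tendsto_of_le_of_le' h hupper
    (Eventually.of_forall (outerMink_le_of_subset hEF hF hnull)) ?_
  filter_upwards [self_mem_nhdsWithin] with ε (hε : 0 < ε)
  exact outerMink_le_mul_outerMink hEΩ hEF hF hconv hC0 hε hε

end
end
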